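/- Every finitely generated linear group over a field of characteristic zero has a torsion-free subgroup of finite index (Selberg's lemma). -/

import Mathlib

/-- The ring of integers is a Jacobson ring. -/
theorem Int.isJacobsonRing : IsJacobsonRing ℤ := by
  rw [isJacobsonRing_iff_prime_eq]
  intro P hP
  by_cases hbot : P = ⊥
  · subst hbot
    rw [eq_bot_iff]
    intro x hx
    by_contra hx0
    obtain ⟨p, hlt, hp⟩ := Nat.exists_infinite_primes (x.natAbs + 1)
    have hmax : (Ideal.span {(p : ℤ)}).IsMaximal :=
      PrincipalIdealRing.isMaximal_of_irreducible (Nat.prime_iff_prime_int.mp hp).irreducible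
    have hxp : x ∈ Ideal.span {(p : ℤ)} := Ideal.mem_sInf.mp hx ⟨bot_le, hmax⟩
    rw [Ideal.mem_span_singleton, Int.natCast_dvd] at hxp
    have := Nat.le_of_dvd (Int.natAbs_pos.mpr hx0) hxp
    omega
  · have := IsPrime.to_maximal_ideal hbot
    exact Ideal.jacobson_eq_self_of_isMaximal

/-- A field that is a quotient of a ring of finite type over `ℤ` is finite. -/
theorem Field.finite_of_surjective_of_finiteType_int {R K : Type*} [CommRing R] [Field K]
    [Algebra.FiniteType ℤ R] (f : R →+* K) (hf : Function.Surjective f) : Finite K := by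
  have : Algebra.FiniteType ℤ K := .of_surjective f.toIntAlgHom hf
  have := Int.isJacobsonRing
  have := finite_of_finite_type_of_isJacobsonRing ℤ K
  obtain ⟨r, hr, hr0⟩ : ∃ r : ℤ, (r : K) = 0 ∧ r ≠ 0 := by
    by_contra! h
    exact Int.not_isField (isField_of_isIntegral_of_isField
      ((injective_iff_map_eq_zero (algebraMap ℤ K)).mpr fun r hr ↦ h r (by simpa using hr))
      (Field.toIsField K))
  refine Module.finite_of_fg_torsion K fun {x} ↦ ⟨⟨r, mem_nonZeroDivisors_of_ne_zero hr0⟩, ?_⟩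
  simp [Submonoid.smul_def, hr]

namespace Matrix

variable {n R : Type*} [Fintype n] [CommRing R]

theorem mul_apply_mem_mul {I J : Ideal R} {M N : Matrix n n R}
    (hM : ∀ i j, M i j ∈ I) (hN : ∀ i j, N i j ∈ J) (i j : n) : (M * N) i j ∈ I * J := by
  rw [mul_apply]
  exact Ideal.sum_mem _ fun k _ ↦ Ideal.mul_mem_mul (hM i k) (hN k j)

theorem mul_apply_mem_left {I : Ideal R} {M : Matrix n n R}
    (hM : ∀ i j, M i j ∈ I) (N : Matrix n n R) (i j : n) : (M * N) i j ∈ I := by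
  rw [mul_apply]
  exact Ideal.sum_mem _ fun k _ ↦ I.mul_mem_right _ (hM i k)

variable [DecidableEq n]

/-- A matrix of exponent `q` that is congruent to `1` modulo a maximal ideal not containing `q`
is the identity. -/
theorem eq_one_of_pow_eq_one_of_sub_one_mem [IsNoetherianRing R] [IsDomain R]
    {m : Ideal R} (hm : m.IsMaximal) {q : ℕ} (hq : (q : R) ∉ m) {g : Matrix n n R}
    (hg : g ^ q = 1) (hgm : ∀ i j, (g - 1) i j ∈ m) : g = 1 := by
  obtain ⟨a, b, hb, hab⟩ := hm.exists_inv hq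
  obtain ⟨X, rfl⟩ : ∃ X, g = X + 1 := ⟨g - 1, by simp⟩
  simp only [add_sub_cancel_right] at hgm
  obtain ⟨Y, hY⟩ : ∃ Y, (X + 1) ^ q = 1 + (q : R) • X + X * X * Y := by
    clear hg hq hab
    induction q with
    | zero => exact ⟨0, by simp⟩
    | succ q ih =>
      obtain ⟨Y, hY⟩ := ih
      refine ⟨(q : R) • 1 + Y * (X + 1), ?_⟩
      rw [pow_succ, hY]
      simp only [add_mul, mul_add, one_mul, mul_one, smul_mul_assoc, mul_smul_comm, Nat.cast_add,
        Nat.cast_one, add_smul, one_smul, mul_assoc]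
      abel
  have hXq : (q : R) • X = -(X * X * Y) := by
    rw [hg] at hY
    rw [eq_neg_iff_add_eq_zero]
    simpa [add_assoc] using hY.symm
  have hpow : ∀ k i j, X i j ∈ m ^ (k + 1) := by
    intro k
    induction k with
    | zero => simpa using hgm
    | succ k ih =>
      intro i j
      have hqX : (q : R) * X i j ∈ m ^ (k + 1 + 1) := by
        have h := congrFun (congrFun hXq i) j
        simp only [smul_apply, smul_eq_mul, neg_apply] at h
        rw [h, pow_succ]
        exact neg_mem (mul_apply_mem_left (mul_apply_mem_mul ih hgm) Y i j)
      have hbX : b * X i j ∈ m ^ (k + 1 + 1) := by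
        rw [pow_succ']
        exact Ideal.mul_mem_mul hb (ih i j)
      have hsum : X i j = a * ((q : R) * X i j) + b * X i j := by
        linear_combination (-X i j) * hab
      rw [hsum]
      exact add_mem (Ideal.mul_mem_left _ _ hqX) hbX
  have hX : X = 0 := by
    ext i j
    have : X i j ∈ ⨅ k, m ^ k := Ideal.mem_iInf.mpr fun k ↦
      Ideal.pow_le_pow_right (Nat.le_succ k) (hpow k i j)
    rwa [Ideal.iInf_pow_eq_bot_of_isDomain m hm.ne_top] at this
  simp [hX]

end Matrix

/-- A domain of characteristic zero and of finite type over `ℤ` has two maximal ideals with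
different residue characteristics. -/
theorem exists_isMaximal_pair_forall_prime_notMem (R : Type*) [CommRing R] [IsDomain R]
    [CharZero R] [Algebra.FiniteType ℤ R] :
    ∃ m₁ m₂ : Ideal R, m₁.IsMaximal ∧ m₂.IsMaximal ∧
      ∀ q : ℕ, q.Prime → (q : R) ∉ m₁ ∨ (q : R) ∉ m₂ := by
  have := Int.isJacobsonRing
  have : IsJacobsonRing R := isJacobsonRing_of_finiteType (A := ℤ)
  obtain ⟨m₁, hm₁⟩ := Ideal.exists_maximal R
  by_cases hp : ∃ p : ℕ, p.Prime ∧ (p : R) ∈ m₁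
  · obtain ⟨p, hp, hpm⟩ := hp
    have hjac : (p : R) ∉ (⊥ : Ideal R).jacobson := by
      rw [← Ideal.radical_eq_jacobson, Ideal.radical_bot_of_isReduced, Ideal.mem_bot]
      exact_mod_cast hp.ne_zero
    obtain ⟨m₂, ⟨-, hm₂⟩, hpm₂⟩ : ∃ m₂ : Ideal R, (⊥ ≤ m₂ ∧ m₂.IsMaximal) ∧ (p : R) ∉ m₂ := by
      simpa [Ideal.jacobson, Ideal.mem_sInf] using hjac
    refine ⟨m₁, m₂, hm₁, hm₂, fun q hq ↦ ?_⟩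
    by_cases hpq : p = q
    · exact .inr (hpq ▸ hpm₂)
    · refine .inl fun hqm ↦ hm₁.ne_top ((Ideal.eq_top_iff_one _).mpr ?_)
      obtain ⟨a, b, hab⟩ : IsCoprime (p : R) (q : R) := by
        simpa using (Nat.Coprime.isCoprime ((Nat.coprime_primes hp hq).mpr hpq)).map
          (Int.castRingHom R)
      rw [← hab]
      exact add_mem (m₁.mul_mem_left _ hpm) (m₁.mul_mem_left _ hqm)
  · exact ⟨m₁, m₁, hm₁, hm₁, fun q hq ↦ .inl fun h ↦ hp ⟨q, hq, h⟩⟩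

/-- An element that is nontrivial and of finite order has a power of prime order. -/
theorem IsOfFinOrder.exists_pow_orderOf_prime {G : Type*} [Monoid G] {x : G}
    (hx : IsOfFinOrder x) (hx1 : x ≠ 1) : ∃ k : ℕ, (orderOf (x ^ k)).Prime := by
  obtain ⟨q, hq, hdvd⟩ := Nat.exists_prime_and_dvd (mt orderOf_eq_one_iff.mp hx1)
  exact ⟨orderOf x / q, by rwa [orderOf_pow_orderOf_div hx.orderOf_pos.ne' hdvd]⟩

namespace Matrix.GeneralLinearGroup

variable {n : Type*} [Fintype n] [DecidableEq n]

theorem map_injective {R S : Type*} [CommRing R] [CommRing S] {f : R →+* S}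
    (hf : Function.Injective f) : Function.Injective (map (n := n) f) :=
  Units.map_injective (Matrix.map_injective hf)

/-- Over a domain of characteristic zero and of finite type over `ℤ`, the general linear group is
virtually torsion-free. -/
theorem exists_finiteIndex_forall_not_isOfFinOrder (R : Type*) [CommRing R] [IsDomain R]
    [CharZero R] [Algebra.FiniteType ℤ R] :
    ∃ H : Subgroup (GL n R), H.FiniteIndex ∧ ∀ x ∈ H, x ≠ 1 → ¬ IsOfFinOrder x := by
  have : IsNoetherianRing R := Algebra.FiniteType.isNoetherianRing ℤ R
  obtain ⟨m₁, m₂, hm₁, hm₂, hm⟩ := exists_isMaximal_pair_forall_prime_notMem R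
  have hindex (m : Ideal R) (hm : m.IsMaximal) :
      (map (n := n) (Ideal.Quotient.mk m)).ker.FiniteIndex := by
    let := Ideal.Quotient.field m
    have : Finite (R ⧸ m) :=
      Field.finite_of_surjective_of_finiteType_int (Ideal.Quotient.mk m) Ideal.Quotient.mk_surjective
    infer_instance
  have htriv (m : Ideal R) (hm : m.IsMaximal) (x : GL n R)
      (hx : x ∈ (map (n := n) (Ideal.Quotient.mk m)).ker)
      (hxm : (orderOf x : R) ∉ m) : x = 1 := by
    refine Units.ext (eq_one_of_pow_eq_one_of_sub_one_mem hm hxm ?_ fun i j ↦ ?_)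
    · rw [← Units.val_pow_eq_pow_val, pow_orderOf_eq_one, Units.val_one]
    · have h := congrArg (fun y : GL n (R ⧸ m) ↦ y i j) (MonoidHom.mem_ker.mp hx)
      simp only [GeneralLinearGroup.map_apply, Units.val_one] at h
      rw [← Ideal.Quotient.eq_zero_iff_mem, Matrix.sub_apply, map_sub, h, Matrix.one_apply,
        Matrix.one_apply]
      split_ifs <;> simp
  have := hindex m₁ hm₁
  have := hindex m₂ hm₂
  refine ⟨(map (Ideal.Quotient.mk m₁)).ker ⊓ (map (Ideal.Quotient.mk m₂)).ker,
    inferInstance, fun x hx hx1 hfin ↦ ?_⟩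
  obtain ⟨k, hk⟩ := hfin.exists_pow_orderOf_prime hx1
  have hxk : x ^ k = 1 := (hm _ hk).elim
    (htriv m₁ hm₁ _ (pow_mem hx.1 k)) (htriv m₂ hm₂ _ (pow_mem hx.2 k))
  simp [hxk, Nat.not_prime_one] at hk

/-- A finitely generated linear group over a commutative ring is defined over a subring of finite
type over `ℤ`. -/
theorem exists_subalgebra_fg_le_range {S : Type*} [CommRing S] {Γ : Subgroup (GL n S)}
    (hΓ : Γ.FG) : ∃ A : Subalgebra ℤ S, A.FG ∧ Γ ≤ (map (n := n) (algebraMap A S)).range := by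
  obtain ⟨T, rfl, hT⟩ := (Subgroup.fg_iff Γ).mp hΓ
  let E : Set S := ⋃ g ∈ T, ⋃ i, ⋃ j, {g.val i j, g.inv i j}
  have hE : E.Finite := hT.biUnion fun g _ ↦ Set.finite_iUnion fun i ↦ Set.finite_iUnion fun j ↦
    Set.toFinite _
  refine ⟨Algebra.adjoin ℤ E, Subalgebra.fg_def.mpr ⟨E, hE, rfl⟩, ?_⟩
  rw [Subgroup.closure_le]
  intro g hg
  have hval (i j : n) : g.val i j ∈ Algebra.adjoin ℤ E := Algebra.subset_adjoin <| by
    simp only [E, Set.mem_iUnion]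
    exact ⟨g, hg, i, j, by simp⟩
  have hinv (i j : n) : g.inv i j ∈ Algebra.adjoin ℤ E := Algebra.subset_adjoin <| by
    simp only [E, Set.mem_iUnion]
    exact ⟨g, hg, i, j, by simp⟩
  have hinj : Function.Injective (fun M : Matrix n n (Algebra.adjoin ℤ E) ↦
      M.map (algebraMap (Algebra.adjoin ℤ E) S)) := Matrix.map_injective Subtype.val_injective
  refine ⟨⟨of fun i j ↦ ⟨g.val i j, hval i j⟩, of fun i j ↦ ⟨g.inv i j, hinv i j⟩,
    hinj ?_, hinj ?_⟩, ?_⟩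
  · simp only [Matrix.map_mul, Matrix.map_one _ (map_zero _) (map_one _)]
    exact g.val_inv
  · simp only [Matrix.map_mul, Matrix.map_one _ (map_zero _) (map_one _)]
    exact g.inv_val
  · ext i j
    rfl

end Matrix.GeneralLinearGroup

/-- Selberg's lemma over an arbitrary field of characteristic zero. -/
theorem Subgroup.exists_finiteIndex_forall_not_isOfFinOrder {n K : Type*} [Fintype n]
    [DecidableEq n] [Field K] [CharZero K] (Γ : Subgroup (GL n K)) [Group.FG Γ] :
    ∃ Γ' : Subgroup Γ, Γ'.FiniteIndex ∧ ∀ x ∈ Γ', x ≠ 1 → ¬ IsOfFinOrder x := by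
  obtain ⟨A, hA, hΓ⟩ := Matrix.GeneralLinearGroup.exists_subalgebra_fg_le_range
    ((Group.fg_iff_subgroup_fg Γ).mp ‹_›)
  have : Algebra.FiniteType ℤ A := A.fg_iff_finiteType.mp hA
  obtain ⟨H, hH, hfree⟩ :=
    Matrix.GeneralLinearGroup.exists_finiteIndex_forall_not_isOfFinOrder (n := n) A
  let e := MonoidHom.ofInjective
    (Matrix.GeneralLinearGroup.map_injective (n := n) (f := algebraMap A K)
      Subtype.val_injective)
  let f : Γ →* GL n A := e.symm.toMonoidHom.comp (Subgroup.inclusion hΓ)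
  have hf : Function.Injective f := e.symm.injective.comp (Subgroup.inclusion_injective hΓ)
  have hindex : (H.comap f).FiniteIndex :=
    ⟨by rw [Subgroup.index_comap]; exact Subgroup.FiniteIndex.index_ne_zero⟩
  refine ⟨H.comap f, hindex, fun x hx hx1 hfin ↦ ?_⟩
  exact hfree (f x) hx ((map_ne_one_iff f hf).mpr hx1) (f.isOfFinOrder hfin)


/-- Selberg's lemma: a finitely generated subgroup `Γ` of `GL(n, ℂ)` has a
torsion-free subgroup of finite index. -/
theorem stmt_16 (n : ℕ) (Γ : Subgroup (GL (Fin n) ℂ)) [Group.FG Γ] :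
    ∃ Γ' : Subgroup Γ, Γ'.FiniteIndex ∧
      ∀ x : Γ, x ∈ Γ' → x ≠ 1 → ¬ IsOfFinOrder x := by
  exact Γ.exists_finiteIndex_forall_not_isOfFinOrder
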